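/- Under the setting of Theorem 4.1 — filtration (𝓕_k)_{k=0,…,K}, standard Gaussian innovations ε_k independent of 𝓕_{k−1}, previsible bounded Y_k, r_k, fixed Λ ∈ Matrix(d,d,ℝ), measurable pointwise-invertible ς : ℝ^d → Matrix(d,d,ℝ) with bounded ς(Y_k) and ς(Y_k)^{-1}, and Σ_Λ, Υ_k, C_K, S_K(y), f_Λ defined as there — assume in addition that ς(y) = diag(h₁,…,h_d) is a diagonal matrix and that there is a constant M ≥ 0 with |(E[f_Λ(r_k·𝟙, Y_k)])_{ij}| ≤ M for all k = 1,…,K and all i, j. Then, for all i, j: |(E[S_K(y)])_{ij} − Δ·(Σ_Λ(y))_{ij}| ≤ Δ²·|h_i|·|h_j|·M. In particular, for fixed K the bias of S_K(y) as an estimator of Δ·Σ_Λ(y) is O(Δ²) as Δ → 0. -/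

import Mathlib

open MeasureTheory ProbabilityTheory Matrix

section StandardGaussian

variable {Ω ι κ : Type*} {mΩ : MeasurableSpace Ω} {P : Measure Ω} [Fintype ι] {e : Ω → ι → ℝ}

lemma measurePreserving_coord_of_map_eq_pi_gaussian (he : Measurable e)
    (hlaw : P.map e = Measure.pi fun _ => gaussianReal 0 1) (l : ι) :
    MeasurePreserving (fun ω => e ω l) P (gaussianReal 0 1) :=
  (measurePreserving_eval (fun _ : ι => gaussianReal 0 1) l).comp ⟨he, hlaw⟩

lemma memLp_two_coord_of_map_eq_pi_gaussian (he : Measurable e)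
    (hlaw : P.map e = Measure.pi fun _ => gaussianReal 0 1) (l : ι) :
    MemLp (fun ω => e ω l) 2 P :=
  (memLp_id_gaussianReal' 2 (by simp)).comp_measurePreserving
    (measurePreserving_coord_of_map_eq_pi_gaussian he hlaw l)

lemma integral_coord_of_map_eq_pi_gaussian (he : Measurable e)
    (hlaw : P.map e = Measure.pi fun _ => gaussianReal 0 1) (l : ι) :
    ∫ ω, e ω l ∂P = 0 := by
  have hmp := measurePreserving_coord_of_map_eq_pi_gaussian he hlaw l
  have := integral_map (μ := P) (f := fun x : ℝ => x) hmp.measurable.aemeasurable (by fun_prop)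
  rw [← this, hmp.map_eq, integral_id_gaussianReal]

lemma integral_coord_mul_coord_of_map_eq_pi_gaussian [DecidableEq ι] [IsProbabilityMeasure P]
    (he : Measurable e)
    (hlaw : P.map e = Measure.pi fun _ => gaussianReal 0 1) (l m : ι) :
    ∫ ω, e ω l * e ω m ∂P = (1 : Matrix ι ι ℝ) l m := by
  have hmeas : ∀ i, Measurable fun ω => e ω i := fun i => (measurable_pi_apply i).comp he
  rcases eq_or_ne l m with rfl | hlm
  · have hmp := measurePreserving_coord_of_map_eq_pi_gaussian he hlaw l
    have hmap := integral_map (μ := P) (f := fun x : ℝ => x ^ 2) hmp.measurable.aemeasurable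
      (by fun_prop)
    have hvar := variance_of_integral_eq_zero (μ := gaussianReal 0 1) (X := fun x : ℝ => x)
      (by fun_prop) integral_id_gaussianReal
    simp only [← pow_two, one_apply_eq]
    rw [← hmap, hmp.map_eq, ← hvar, variance_fun_id_gaussianReal]
    simp
  · have hind : iIndepFun (fun i ω => e ω i) P := by
      rw [iIndepFun_iff_map_fun_eq_pi_map fun i => (hmeas i).aemeasurable]
      simp_rw [fun i => (measurePreserving_coord_of_map_eq_pi_gaussian he hlaw i).map_eq]
      exact hlaw
    rw [(hind.indepFun hlm).integral_fun_mul_eq_mul_integral (hmeas l).aestronglyMeasurable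
      (hmeas m).aestronglyMeasurable, integral_coord_of_map_eq_pi_gaussian he hlaw,
      zero_mul, one_apply_ne hlm]

lemma integral_mulVec_mul_mulVec_of_map_eq_pi_gaussian [IsProbabilityMeasure P]
    (he : Measurable e) (hlaw : P.map e = Measure.pi fun _ => gaussianReal 0 1)
    (L : Matrix κ ι ℝ) (i j : κ) :
    ∫ ω, (L *ᵥ e ω) i * (L *ᵥ e ω) j ∂P = (L * Lᵀ) i j := by
  classical
  have hint : ∀ l m, Integrable (fun ω => L i l * e ω l * (L j m * e ω m)) P := fun l m =>
    ((memLp_two_coord_of_map_eq_pi_gaussian he hlaw l).const_mul (L i l)).integrable_mul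
      ((memLp_two_coord_of_map_eq_pi_gaussian he hlaw m).const_mul (L j m))
  simp only [mulVec, dotProduct, Finset.sum_mul_sum]
  rw [integral_finsetSum _ fun l _ => integrable_finsetSum _ fun m _ => hint l m]
  rw [Finset.sum_congr rfl fun l _ => integral_finsetSum _ fun m _ => hint l m]
  simp_rw [fun l m ω => mul_mul_mul_comm (L i l) (e ω l) (L j m) (e ω m), integral_const_mul,
    integral_coord_mul_coord_of_map_eq_pi_gaussian he hlaw]
  simp [one_apply, mul_apply]

lemma memLp_two_mulVec_of_map_eq_pi_gaussian
    (he : Measurable e) (hlaw : P.map e = Measure.pi fun _ => gaussianReal 0 1)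
    (L : Matrix κ ι ℝ) (i : κ) :
    MemLp (fun ω => (L *ᵥ e ω) i) 2 P :=
  memLp_finsetSum _ fun l _ =>
    (memLp_two_coord_of_map_eq_pi_gaussian he hlaw l).const_mul (L i l)

lemma integral_mulVec_of_map_eq_pi_gaussian [IsFiniteMeasure P]
    (he : Measurable e) (hlaw : P.map e = Measure.pi fun _ => gaussianReal 0 1)
    (L : Matrix κ ι ℝ) (i : κ) :
    ∫ ω, (L *ᵥ e ω) i ∂P = 0 := by
  simp only [mulVec, dotProduct]
  rw [integral_finsetSum _ fun l _ =>
    ((memLp_two_coord_of_map_eq_pi_gaussian he hlaw l).integrable (by norm_num)).const_mul (L i l)]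
  simp [integral_const_mul, integral_coord_of_map_eq_pi_gaussian he hlaw]

end StandardGaussian

/-- Second moments of an affine image of a standard Gaussian vector whose drift is
square-integrable and independent of the Gaussian vector. -/
lemma integral_affine_mul_affine_of_indep {Ω ι κ : Type*} {m mΩ : MeasurableSpace Ω} {P : Measure Ω}
    [IsProbabilityMeasure P] [Fintype ι] {e : Ω → ι → ℝ}
    (he : Measurable e) (hlaw : P.map e = Measure.pi fun _ => gaussianReal 0 1)
    (hindep : Indep (MeasurableSpace.comap e inferInstance) m P)
    (L : Matrix κ ι ℝ) {a : Ω → κ → ℝ} (ha : ∀ i, Measurable[m] fun ω => a ω i)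
    (ha2 : ∀ i, MemLp (fun ω => a ω i) 2 P) (s t : ℝ) (i j : κ) :
    Integrable (fun ω => (s * a ω i + t * (L *ᵥ e ω) i) * (s * a ω j + t * (L *ᵥ e ω) j)) P ∧
    ∫ ω, (s * a ω i + t * (L *ᵥ e ω) i) * (s * a ω j + t * (L *ᵥ e ω) j) ∂P =
      s ^ 2 * ∫ ω, a ω i * a ω j ∂P + t ^ 2 * (L * Lᵀ) i j := by
  have hg := memLp_two_mulVec_of_map_eq_pi_gaussian he hlaw L
  have hcross : ∀ i j, ∫ ω, a ω i * (L *ᵥ e ω) j ∂P = 0 := by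
    intro i j
    have hmeas : Measurable[MeasurableSpace.comap e inferInstance] fun ω => (L *ᵥ e ω) j := by
      have : Measurable fun x : ι → ℝ => (L *ᵥ x) j := by
        simp only [mulVec, dotProduct]
        fun_prop
      exact this.comp (comap_measurable e)
    have hind : IndepFun (fun ω => a ω i) (fun ω => (L *ᵥ e ω) j) P := by
      rw [IndepFun_iff_Indep]
      exact (indep_of_indep_of_le hindep hmeas.comap_le (ha i).comap_le).symm
    rw [hind.integral_fun_mul_eq_mul_integral (ha2 i).aestronglyMeasurable
      (hg j).aestronglyMeasurable, integral_mulVec_of_map_eq_pi_gaussian he hlaw, mul_zero]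
  have h1 : Integrable (fun ω => s ^ 2 * (a ω i * a ω j)) P :=
    ((ha2 i).integrable_mul (ha2 j)).const_mul _
  have h2 : Integrable (fun ω => s * t * (a ω i * (L *ᵥ e ω) j)) P :=
    ((ha2 i).integrable_mul (hg j)).const_mul _
  have h3 : Integrable (fun ω => s * t * (a ω j * (L *ᵥ e ω) i)) P :=
    ((ha2 j).integrable_mul (hg i)).const_mul _
  have h4 : Integrable (fun ω => t ^ 2 * ((L *ᵥ e ω) i * (L *ᵥ e ω) j)) P :=
    ((hg i).integrable_mul (hg j)).const_mul _
  have hexpand : (fun ω => (s * a ω i + t * (L *ᵥ e ω) i) * (s * a ω j + t * (L *ᵥ e ω) j)) =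
      fun ω => s ^ 2 * (a ω i * a ω j) + s * t * (a ω i * (L *ᵥ e ω) j)
        + s * t * (a ω j * (L *ᵥ e ω) i) + t ^ 2 * ((L *ᵥ e ω) i * (L *ᵥ e ω) j) := by
    funext ω
    ring
  rw [hexpand]
  have h12 : Integrable (fun ω => s ^ 2 * (a ω i * a ω j) + s * t * (a ω i * (L *ᵥ e ω) j)) P :=
    h1.add h2
  have h123 : Integrable (fun ω => s ^ 2 * (a ω i * a ω j) + s * t * (a ω i * (L *ᵥ e ω) j)
      + s * t * (a ω j * (L *ᵥ e ω) i)) P := h12.add h3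
  refine ⟨h123.add h4, ?_⟩
  rw [integral_add h123 h4, integral_add h12 h3, integral_add h1 h2]
  simp_rw [integral_const_mul]
  rw [hcross, hcross, integral_mulVec_mul_mulVec_of_map_eq_pi_gaussian he hlaw]
  ring

section BoundedMatrix

variable {Ω l m n : Type*} [Fintype m]

lemma Matrix.exists_abs_mul_apply_le [Nonempty Ω] {A : Ω → Matrix l m ℝ} {B : Ω → Matrix m n ℝ}
    {a b : ℝ}
    (hA : ∀ ω i j, |A ω i j| ≤ a) (hB : ∀ ω i j, |B ω i j| ≤ b) :
    ∃ c, ∀ ω i j, |(A ω * B ω) i j| ≤ c := by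
  refine ⟨∑ _ : m, a * b, fun ω i j => ?_⟩
  rw [mul_apply]
  refine (Finset.abs_sum_le_sum_abs _ _).trans (Finset.sum_le_sum fun k _ => ?_)
  rw [abs_mul]
  exact mul_le_mul (hA _ _ _) (hB _ _ _) (abs_nonneg _) ((abs_nonneg _).trans (hA ω i k))

end BoundedMatrix

lemma measurable_matrix_mul_apply {α l m n : Type*} [MeasurableSpace α] [Fintype m]
    {A : α → Matrix l m ℝ} {B : α → Matrix m n ℝ} (hA : ∀ i j, Measurable fun x => A x i j)
    (hB : ∀ i j, Measurable fun x => B x i j) (i : l) (j : n) :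
    Measurable fun x => (A x * B x) i j := by
  simp only [mul_apply]
  exact Finset.measurable_fun_sum _ fun k _ => (hA i k).mul (hB k j)

lemma measurable_matrix_inv_apply {α n : Type*} [MeasurableSpace α] [Fintype n] [DecidableEq n]
    {A : α → Matrix n n ℝ} (hA : ∀ i j, Measurable fun x => A x i j) (i j : n) :
    Measurable fun x => (A x)⁻¹ i j := by
  have hdet : ∀ {B : α → Matrix n n ℝ}, (∀ i j, Measurable fun x => B x i j) →
      Measurable fun x => (B x).det := by
    intro B hB
    simp only [det_apply']
    fun_prop
  simp only [inv_def, Ring.inverse_eq_inv', Matrix.smul_apply, smul_eq_mul, adjugate_apply]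
  refine (hdet hA).inv.mul (hdet fun k l => ?_)
  rcases eq_or_ne k j with rfl | hk
  · simp
  · simpa [updateRow_ne hk] using hA k l

/-- Asymptotic bias statement (equation (5)): in the setting of Theorem 4.1, if
`ς(y) = diag(h₁,…,h_d)` and the entries of `E[f_Λ(r_k·𝟙, Y_k)]` are bounded by `M`,
then `|(E[S_K(y)])_{ij} − Δ·(Σ_Λ(y))_{ij}| ≤ Δ²·|h_i|·|h_j|·M` for all `i, j`;
i.e. for fixed `K` the bias of `S_K(y)` for `Δ·Σ_Λ(y)` is `O(Δ²)` as `Δ → 0`. -/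
theorem consistent_yield_estimator_bias_bound
    {Ω : Type*} {mΩ : MeasurableSpace Ω} (P : Measure Ω) [IsProbabilityMeasure P]
    (K : ℕ) (hK : 1 ≤ K) (d : ℕ) (hd : 1 ≤ d) (Δ : ℝ) (hΔ : 0 < Δ)
    (𝓕 : ℕ → MeasurableSpace Ω) (h𝓕_mono : Monotone 𝓕) (h𝓕_le : ∀ k, 𝓕 k ≤ mΩ)
    (L : Matrix (Fin d) (Fin d) ℝ)
    (ς : (Fin d → ℝ) → Matrix (Fin d) (Fin d) ℝ)
    (hς_meas : ∀ i j, Measurable fun x => ς x i j)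
    (hς_inv : ∀ x, IsUnit (ς x).det)
    (ε : ℕ → Ω → (Fin d → ℝ))
    (hε_meas : ∀ k ∈ Finset.Icc 1 K, Measurable[𝓕 k] (ε k))
    (hε_law : ∀ k ∈ Finset.Icc 1 K,
      @Measure.map Ω (Fin d → ℝ) mΩ _ (ε k) P
        = Measure.pi (fun _ : Fin d => gaussianReal 0 1))
    (hε_indep : ∀ k ∈ Finset.Icc 1 K,
      Indep (MeasurableSpace.comap (ε k) inferInstance) (𝓕 (k - 1)) P)
    (Y : ℕ → Ω → (Fin d → ℝ)) (r : ℕ → Ω → ℝ)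
    (hY_meas : ∀ k ∈ Finset.Icc 1 K, Measurable[𝓕 (k - 1)] (Y k))
    (hr_meas : ∀ k ∈ Finset.Icc 1 K, Measurable[𝓕 (k - 1)] (r k))
    (Cb : ℝ)
    (h_bd : ∀ k ∈ Finset.Icc 1 K, ∀ ω, |r k ω| ≤ Cb
      ∧ (∀ i j, |ς (Y k ω) i j| ≤ Cb) ∧ (∀ i j, |(ς (Y k ω))⁻¹ i j| ≤ Cb))
    (SgL : (Fin d → ℝ) → Matrix (Fin d) (Fin d) ℝ)
    (hSgL : ∀ x, SgL x = ς x * L * Lᵀ * (ς x)ᵀ)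
    (Υ : ℕ → Ω → (Fin d → ℝ))
    (hΥ : ∀ k ∈ Finset.Icc 1 K, ∀ ω, ∀ j, Υ k ω j
      = Δ * (-(r k ω) + SgL (Y k ω) j j / 2) + Real.sqrt Δ * ((ς (Y k ω) * L) *ᵥ ε k ω) j)
    (CK : Ω → Matrix (Fin d) (Fin K) ℝ)
    (hCK : ∀ ω, ∀ i, ∀ k : Fin K,
      CK ω i k = (Real.sqrt K)⁻¹ * ((ς (Y ((k : ℕ) + 1) ω))⁻¹ *ᵥ Υ ((k : ℕ) + 1) ω) i)
    (fL : (Fin d → ℝ) → (Fin d → ℝ) → Matrix (Fin d) (Fin d) ℝ)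
    (hfL : ∀ z x, fL z x = (ς x)⁻¹
      * vecMulVec (fun j => -z j + SgL x j j / 2) (fun j => -z j + SgL x j j / 2)
      * ((ς x)⁻¹)ᵀ)
    (y : Fin d → ℝ)
    (S : Ω → Matrix (Fin d) (Fin d) ℝ)
    (hS : ∀ ω, S ω = ς y * (CK ω * (CK ω)ᵀ) * (ς y)ᵀ)
    -- additional assumptions: `ς(y)` is diagonal and the entries of
    -- `E[f_Λ(r_k·𝟙, Y_k)]` are bounded by `M`
    (h : Fin d → ℝ) (hςy_diag : ς y = Matrix.diagonal h)
    (M : ℝ) (hM : 0 ≤ M)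
    (h_fL_bd : ∀ k ∈ Finset.Icc 1 K, ∀ i j,
      |∫ ω, fL (fun _ => r k ω) (Y k ω) i j ∂P| ≤ M) :
    ∀ i j, |(∫ ω, S ω i j ∂P) - Δ * SgL y i j| ≤ Δ ^ 2 * |h i| * |h j| * M := by
  intro i j
  have : Nonempty Ω := nonempty_of_isProbabilityMeasure P
  obtain ⟨drift, hdrift⟩ : ∃ f : ℝ → (Fin d → ℝ) → Fin d → ℝ,
      ∀ z x, f z x = (ς x)⁻¹ *ᵥ fun l => -z + SgL x l l / 2 := ⟨_, fun _ _ => rfl⟩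
  obtain ⟨a, ha⟩ : ∃ a : ℕ → Ω → Fin d → ℝ, ∀ k ω, a k ω = drift (r k ω) (Y k ω) :=
    ⟨_, fun _ _ => rfl⟩
  have hfa : ∀ k ω i j, fL (fun _ => r k ω) (Y k ω) i j = a k ω i * a k ω j := by
    intro k ω i j
    rw [hfL, mul_vecMulVec, vecMulVec_mul, vecMul_transpose, vecMulVec_apply, ha, hdrift]
  have hdrift_meas : ∀ i, Measurable fun p : ℝ × (Fin d → ℝ) => drift p.1 p.2 i := by
    intro i
    have hςL := measurable_matrix_mul_apply hς_meas fun l m => measurable_const (a := L l m)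
    have hSgL_meas : ∀ l, Measurable fun x => SgL x l l := fun l => by
      have := measurable_matrix_mul_apply (B := fun x => (ς x * L)ᵀ) hςL (fun l m => hςL m l) l l
      simpa only [hSgL, transpose_mul, Matrix.mul_assoc] using this
    have hvec : ∀ l, Measurable fun p : ℝ × (Fin d → ℝ) => -p.1 + SgL p.2 l l / 2 := fun l =>
      measurable_fst.neg.add (((hSgL_meas l).comp measurable_snd).div_const 2)
    simp only [hdrift]
    exact measurable_matrix_mul_apply
      (B := fun p : ℝ × (Fin d → ℝ) => replicateCol Unit fun l => -p.1 + SgL p.2 l l / 2)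
      (fun l m => (measurable_matrix_inv_apply hς_meas l m).comp measurable_snd)
      (fun l _ => hvec l) i ()
  have ha_meas : ∀ k ∈ Finset.Icc 1 K, ∀ i, Measurable[𝓕 (k - 1)] fun ω => a k ω i := by
    intro k hk i
    simp only [ha]
    exact (hdrift_meas i).comp ((hr_meas k hk).prodMk (hY_meas k hk))
  have ha_memLp : ∀ k ∈ Finset.Icc 1 K, ∀ i, MemLp (fun ω => a k ω i) 2 P := by
    intro k hk i
    obtain ⟨c, hc⟩ : ∃ c, ∀ ω l m, |SgL (Y k ω) l m| ≤ c := by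
      obtain ⟨cL, hcL⟩ := Matrix.exists_abs_mul_apply_le (A := fun ω => ς (Y k ω))
        (B := fun _ : Ω => L) (b := ∑ l, ∑ m, |L l m|) (fun ω => (h_bd k hk ω).2.1)
        fun _ l m => (Finset.single_le_sum (f := fun m => |L l m|) (fun _ _ => abs_nonneg _)
          (Finset.mem_univ m)).trans (Finset.single_le_sum (f := fun l => ∑ m, |L l m|)
          (fun _ _ => Finset.sum_nonneg fun _ _ => abs_nonneg _) (Finset.mem_univ l))
      obtain ⟨c, hc⟩ := Matrix.exists_abs_mul_apply_le (A := fun ω => ς (Y k ω) * L)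
        (B := fun ω => (ς (Y k ω) * L)ᵀ) hcL fun ω l m => hcL ω m l
      refine ⟨c, fun ω l m => ?_⟩
      have := hc ω l m
      rwa [transpose_mul, ← Matrix.mul_assoc, ← hSgL] at this
    obtain ⟨b, hb⟩ := Matrix.exists_abs_mul_apply_le (A := fun ω => (ς (Y k ω))⁻¹)
      (B := fun ω => replicateCol Unit fun l => -(r k ω) + SgL (Y k ω) l l / 2)
      (b := Cb + c / 2) (fun ω => (h_bd k hk ω).2.2) fun ω l _ => by
        have h1 := abs_le.1 (h_bd k hk ω).1
        have h2 := abs_le.1 (hc ω l l)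
        rw [replicateCol_apply, abs_le]
        constructor <;> linarith
    exact MemLp.of_bound ((ha_meas k hk i).mono (h𝓕_le _) le_rfl).aestronglyMeasurable b
      (.of_forall fun ω => by
        rw [ha, hdrift]
        exact hb ω i ())
  have hincr : ∀ k ∈ Finset.Icc 1 K, ∀ ω i, ((ς (Y k ω))⁻¹ *ᵥ Υ k ω) i =
      Δ * a k ω i + √Δ * (L *ᵥ ε k ω) i := by
    intro k hk ω i
    have hvec : Υ k ω = Δ • (fun l => -(r k ω) + SgL (Y k ω) l l / 2)
        + √Δ • ((ς (Y k ω) * L) *ᵥ ε k ω) := funext (hΥ k hk ω)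
    rw [hvec, mulVec_add, mulVec_smul, mulVec_smul, mulVec_mulVec, ← Matrix.mul_assoc,
      nonsing_inv_mul _ (hς_inv _), Matrix.one_mul, ha, hdrift]
    rfl
  have hmoment : ∀ k ∈ Finset.Icc 1 K, _ := fun k hk =>
    integral_affine_mul_affine_of_indep
      ((hε_meas k hk).mono (h𝓕_le k) le_rfl) (hε_law k hk) (hε_indep k hk) L
      (ha_meas k hk) (ha_memLp k hk) Δ √Δ i j
  have hmem : ∀ k : Fin K, (k : ℕ) + 1 ∈ Finset.Icc 1 K := fun k =>
    Finset.mem_Icc.2 ⟨Nat.le_add_left _ _, k.2⟩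
  have hK0 : (K : ℝ) ≠ 0 := by positivity
  have hS_apply : ∀ ω, S ω i j = h i * h j * (K : ℝ)⁻¹ * ∑ k : Fin K,
      (Δ * a (k + 1) ω i + √Δ * (L *ᵥ ε (k + 1) ω) i)
        * (Δ * a (k + 1) ω j + √Δ * (L *ᵥ ε (k + 1) ω) j) := by
    intro ω
    have hsq : (√(K : ℝ))⁻¹ * (√(K : ℝ))⁻¹ = (K : ℝ)⁻¹ := by
      rw [← mul_inv, Real.mul_self_sqrt K.cast_nonneg]
    rw [hS, hςy_diag, diagonal_transpose, mul_diagonal, diagonal_mul, mul_apply, ← hsq,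
      Finset.mul_sum, Finset.mul_sum, Finset.sum_mul]
    refine Finset.sum_congr rfl fun k _ => ?_
    rw [transpose_apply, hCK, hCK, hincr _ (hmem k), hincr _ (hmem k)]
    ring
  have hSgL_apply : SgL y i j = h i * h j * (L * Lᵀ) i j := by
    rw [hSgL, hςy_diag, diagonal_transpose, mul_diagonal, Matrix.mul_assoc, diagonal_mul]
    ring
  have hbias : (∫ ω, S ω i j ∂P) - Δ * SgL y i j = Δ ^ 2 * (h i * h j) *
      ((K : ℝ)⁻¹ * ∑ k : Fin K, ∫ ω, fL (fun _ => r (k + 1) ω) (Y (k + 1) ω) i j ∂P) := by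
    simp_rw [hS_apply, integral_const_mul]
    rw [integral_finsetSum _ fun k _ => (hmoment _ (hmem k)).1,
      Finset.sum_congr rfl fun k _ => (hmoment _ (hmem k)).2]
    simp_rw [hfa]
    rw [Finset.sum_add_distrib, ← Finset.mul_sum, Finset.sum_const, Finset.card_univ,
      Fintype.card_fin, nsmul_eq_mul, Real.sq_sqrt hΔ.le, hSgL_apply]
    field_simp
    ring
  have hmean : |(K : ℝ)⁻¹ * ∑ k : Fin K,
      ∫ ω, fL (fun _ => r (k + 1) ω) (Y (k + 1) ω) i j ∂P| ≤ M := by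
    rw [abs_mul, abs_of_nonneg (by positivity : (0 : ℝ) ≤ (K : ℝ)⁻¹),
      inv_mul_le_iff₀ (by positivity)]
    refine (Finset.abs_sum_le_sum_abs _ _).trans
      ((Finset.sum_le_sum fun k _ => h_fL_bd _ (hmem k) i j).trans_eq ?_)
    simp
  rw [hbias, abs_mul, abs_mul, abs_mul, abs_of_nonneg (sq_nonneg Δ), ← mul_assoc]
  exact mul_le_mul_of_nonneg_left hmean (by positivity)
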